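/- arXiv:1704.05434 — 2 statements merged into one kernel-verified Lean document; each statement's English description precedes it below -/
import Mathlib

section
/- Let L be the Laplacian matrix of a connected weighted undirected graph on n ≥ 2 vertices (so Lᵢᵢ > 0 for all i), let σ₁,…,σₙ ∈ [0,1) with σ_max = maxᵢ σᵢ, and let ‖L‖ denote the induced 2-norm of L. If x̂, e ∈ ℝⁿ satisfy Lᵢᵢ eᵢ² ≤ (σᵢ/2) q̂ᵢ(x̂) for every i, where q̂ᵢ(x̂) = −(1/2) Σⱼ Lᵢⱼ (x̂ⱼ − x̂ᵢ)², then with x = x̂ − e one has xᵀLx ≤ (2 + ‖L‖σ_max / minᵢ Lᵢᵢ) · x̂ᵀLx̂. -/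
open Matrix BigOperators

lemma quad_aux (n : ℕ) (A : Matrix (Fin n) (Fin n) ℝ) (hAsymm : A.IsSymm)
    (v : Fin n → ℝ) :
    v ⬝ᵥ (Matrix.diagonal (fun i => ∑ j, A i j) - A).mulVec v
      = 1/2 * ∑ i, ∑ j, A i j * (v j - v i)^2 := by
  have h1 : ∑ i, ∑ j, A i j * (v j)^2 = ∑ i, ∑ j, A i j * (v i)^2 := by
    rw [Finset.sum_comm]
    refine Finset.sum_congr rfl fun i _ => Finset.sum_congr rfl fun j _ => ?_
    rw [hAsymm.apply]
  have h2 : ∑ i, ∑ j, A i j * (v j - v i)^2 = ∑ i, ∑ j, A i j * (v j)^2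
      + ∑ i, ∑ j, A i j * (v i)^2 - 2 * ∑ i, ∑ j, A i j * (v i * v j) := by
    simp only [Finset.mul_sum, ← Finset.sum_add_distrib, ← Finset.sum_sub_distrib]
    refine Finset.sum_congr rfl fun i _ => Finset.sum_congr rfl fun j _ => ?_
    ring
  have h3 : v ⬝ᵥ (Matrix.diagonal (fun i => ∑ j, A i j) - A).mulVec v
      = ∑ i, ∑ j, A i j * (v i)^2 - ∑ i, ∑ j, A i j * (v i * v j) := by
    rw [Matrix.sub_mulVec, dotProduct_sub]
    congr 1
    · simp only [dotProduct, Matrix.mulVec_diagonal]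
      refine Finset.sum_congr rfl fun i _ => ?_
      rw [← Finset.sum_mul]; ring
    · simp only [dotProduct, Matrix.mulVec, Finset.mul_sum]
      refine Finset.sum_congr rfl fun i _ => Finset.sum_congr rfl fun j _ => ?_
      ring
  rw [h3, h2, h1]; ring

lemma norm_aux (n : ℕ) (L : Matrix (Fin n) (Fin n) ℝ) (e : Fin n → ℝ) :
    e ⬝ᵥ L.mulVec e ≤ ‖(Matrix.toEuclideanCLM (𝕜 := ℝ) L :
      EuclideanSpace ℝ (Fin n) →L[ℝ] EuclideanSpace ℝ (Fin n))‖ * ∑ i, (e i)^2 := by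
  set T := (Matrix.toEuclideanCLM (𝕜 := ℝ) L :
      EuclideanSpace ℝ (Fin n) →L[ℝ] EuclideanSpace ℝ (Fin n)) with hT
  set v : EuclideanSpace ℝ (Fin n) := WithLp.toLp 2 e with hv
  have h1 : e ⬝ᵥ L.mulVec e = inner ℝ v (T v) := by
    simp [hT, hv, Matrix.toEuclideanCLM_toLp, EuclideanSpace.inner_toLp_toLp, dotProduct_comm]
  have h2 : ∑ i, (e i)^2 = ‖v‖^2 := by
    simp [EuclideanSpace.norm_sq_eq, hv]
  rw [h1, h2]
  calc inner ℝ v (T v) ≤ ‖v‖ * ‖T v‖ := real_inner_le_norm _ _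
    _ ≤ ‖v‖ * (‖T‖ * ‖v‖) := by gcongr; exact T.le_opNorm v
    _ = _ := by ring

/-- inequality (25): under the static triggering condition
`Lᵢᵢ eᵢ² ≤ (σᵢ/2) q̂ᵢ(x̂)`, with `x = x̂ − e` one has
`xᵀLx ≤ (2 + ‖L‖σ_max / minᵢ Lᵢᵢ) x̂ᵀLx̂`. -/
theorem quadform_bound_static_discontinuous
    (n : ℕ) (hn : 2 ≤ n)
    (A : Matrix (Fin n) (Fin n) ℝ)
    (hAsymm : A.IsSymm)
    (hAnonneg : ∀ i j, 0 ≤ A i j)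
    (hAdiag : ∀ i, A i i = 0)
    (hconn : (SimpleGraph.fromRel (fun i j => 0 < A i j)).Connected)
    (L : Matrix (Fin n) (Fin n) ℝ)
    (hL : L = Matrix.diagonal (fun i => ∑ j, A i j) - A)
    (σ : Fin n → ℝ) (hσ : ∀ i, σ i ∈ Set.Ico (0 : ℝ) 1)
    (σmax : ℝ) (hσmax : IsGreatest (Set.range σ) σmax)
    (normL : ℝ)
    (hnormL : normL = ‖(Matrix.toEuclideanCLM (𝕜 := ℝ) L :
      EuclideanSpace ℝ (Fin n) →L[ℝ] EuclideanSpace ℝ (Fin n))‖)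
    (m : ℝ) (hm : IsLeast (Set.range fun i => L i i) m)
    (xhat e : Fin n → ℝ)
    (qhat : Fin n → ℝ)
    (hqhat : ∀ i, qhat i = -(1/2) * ∑ j, L i j * (xhat j - xhat i)^2)
    (htrig : ∀ i, L i i * (e i)^2 ≤ σ i / 2 * qhat i) :
    (xhat - e) ⬝ᵥ L.mulVec (xhat - e) ≤
      (2 + normL * σmax / m) * (xhat ⬝ᵥ L.mulVec xhat) := by
  have hnt : Nontrivial (Fin n) := Fin.nontrivial_iff_two_le.mpr hn
  have hLii : ∀ i, L i i = ∑ j, A i j := by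
    intro i; simp [hL, hAdiag]
  have hmpos : 0 < m := by
    obtain ⟨i, hi⟩ := hm.1
    obtain ⟨j, hj⟩ := hconn.preconnected.exists_adj_of_nontrivial i
    simp only at hi
    rw [← hi, hLii]
    refine Finset.sum_pos' (fun j _ => hAnonneg i j) ⟨j, Finset.mem_univ _, ?_⟩
    rw [SimpleGraph.fromRel_adj] at hj
    rcases hj.2 with h | h
    · exact h
    · rwa [hAsymm.apply] at h
  have hq : ∀ i, qhat i = 1/2 * ∑ j, A i j * (xhat j - xhat i)^2 := by
    intro i
    rw [hqhat i, neg_mul, ← mul_neg, ← Finset.sum_neg_distrib]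
    congr 1
    refine Finset.sum_congr rfl fun j _ => ?_
    by_cases h : i = j
    · subst h; simp
    · simp [hL, Matrix.diagonal_apply_ne _ h]
  have hq0 : ∀ i, 0 ≤ qhat i := by
    intro i; rw [hq]
    exact mul_nonneg (by norm_num)
      (Finset.sum_nonneg fun j _ => mul_nonneg (hAnonneg i j) (sq_nonneg _))
  have hQ : xhat ⬝ᵥ L.mulVec xhat = ∑ i, qhat i := by
    rw [hL, quad_aux n A hAsymm, Finset.mul_sum]
    exact Finset.sum_congr rfl fun i _ => (hq i).symm
  have hpar : (xhat - e) ⬝ᵥ L.mulVec (xhat - e) + (xhat + e) ⬝ᵥ L.mulVec (xhat + e)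
      = 2 * (xhat ⬝ᵥ L.mulVec xhat) + 2 * (e ⬝ᵥ L.mulVec e) := by
    simp only [Matrix.mulVec_sub, Matrix.mulVec_add, dotProduct_sub, dotProduct_add,
      sub_dotProduct, add_dotProduct]
    ring
  have hpsd : 0 ≤ (xhat + e) ⬝ᵥ L.mulVec (xhat + e) := by
    rw [hL, quad_aux n A hAsymm]
    exact mul_nonneg (by norm_num) (Finset.sum_nonneg fun i _ =>
      Finset.sum_nonneg fun j _ => mul_nonneg (hAnonneg i j) (sq_nonneg _))
  have he : m * ∑ i, (e i)^2 ≤ σmax / 2 * ∑ i, qhat i := by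
    rw [Finset.mul_sum, Finset.mul_sum]
    refine Finset.sum_le_sum fun i _ => ?_
    have h1 : m ≤ L i i := hm.2 ⟨i, rfl⟩
    have h2 : σ i ≤ σmax := hσmax.2 ⟨i, rfl⟩
    have h3 := mul_le_mul_of_nonneg_right h1 (sq_nonneg (e i))
    have h4 := mul_le_mul_of_nonneg_right h2 (hq0 i)
    have h5 := htrig i
    linarith
  have hn0 : 0 ≤ normL := by rw [hnormL]; exact norm_nonneg _
  have hne := norm_aux n L e
  rw [← hnormL] at hne
  have he' : ∑ i, (e i)^2 ≤ σmax / 2 * (∑ i, qhat i) / m := by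
    rw [le_div_iff₀ hmpos]; linarith
  have h6 := mul_le_mul_of_nonneg_left he' hn0
  have h7 : (2 + normL * σmax / m) * (xhat ⬝ᵥ L.mulVec xhat)
      = 2 * (xhat ⬝ᵥ L.mulVec xhat) + 2 * (normL * (σmax / 2 * (∑ i, qhat i) / m)) := by
    rw [hQ]; ring
  rw [h7]
  linarith
end

section
/- Consider a connected weighted undirected graph on n ≥ 2 vertices with Laplacian L, constants σ₁,…,σₙ ∈ (0,1), σ_max = maxᵢ σᵢ. Let x : [0,∞) → ℝⁿ be differentiable and x̂ : [0,∞) → ℝⁿ be such that ẋ(t) = −L x̂(t) for all t ≥ 0 and, with e(t) = x̂(t) − x(t), the static triggering condition eᵢ(t)² ≤ (σᵢ/(2Lᵢᵢ)) q̂ᵢ(x̂(t)) holds for every i and every t ≥ 0, where q̂ᵢ(x̂) = −(1/2) Σⱼ Lᵢⱼ (x̂ⱼ − x̂ᵢ)². Then, with V(t) = (1/2) Σᵢ (xᵢ(t) − x̄(0))², one has V(t) ≤ V(0) · exp(−((1 − σ_max) minᵢ Lᵢᵢ / (2 minᵢ Lᵢᵢ + ‖L‖σ_max)) ρ₂(L)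 t) for all t ≥ 0; in particular each xᵢ(t) converges exponentially to the initial average x̄(0) = (1/n) Σᵢ xᵢ(0). -/
open Matrix BigOperators

lemma aux_const {n : ℕ} {A : Matrix (Fin n) (Fin n) ℝ}
    (hconn : (SimpleGraph.fromRel (fun i j => 0 < A i j)).Connected)
    (v : Fin n → ℝ) (h : ∀ i j, 0 < A i j → v i = v j) (i j : Fin n) : v i = v j := by
  obtain ⟨w⟩ := hconn.preconnected i j
  induction w with
  | nil => rfl
  | cons hadj _ ih =>
    rw [SimpleGraph.fromRel_adj] at hadj
    rw [← ih]
    rcases hadj.2 with h1 | h1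
    · exact h _ _ h1
    · exact (h _ _ h1).symm

lemma aux_mulVec {n : ℕ} (A L : Matrix (Fin n) (Fin n) ℝ)
    (hL : L = Matrix.diagonal (fun i => ∑ j, A i j) - A) (v : Fin n → ℝ) (i : Fin n) :
    (L *ᵥ v) i = ∑ j, A i j * (v i - v j) := by
  subst hL
  rw [Matrix.sub_mulVec, Pi.sub_apply, Matrix.mulVec_diagonal]
  simp only [Matrix.mulVec, dotProduct, mul_sub, Finset.sum_sub_distrib, Finset.sum_mul]

lemma aux_quad {n : ℕ} (A L : Matrix (Fin n) (Fin n) ℝ) (hAsymm : A.IsSymm)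
    (hL : L = Matrix.diagonal (fun i => ∑ j, A i j) - A) (u v : Fin n → ℝ) :
    u ⬝ᵥ (L *ᵥ v) = (1/2) * ∑ i, ∑ j, A i j * ((u i - u j) * (v i - v j)) := by
  have h1 : u ⬝ᵥ (L *ᵥ v) = ∑ i, ∑ j, A i j * (u i * (v i - v j)) := by
    simp only [dotProduct, aux_mulVec A L hL, Finset.mul_sum]
    refine Finset.sum_congr rfl fun i _ => Finset.sum_congr rfl fun j _ => by ring
  have h2 : u ⬝ᵥ (L *ᵥ v) = ∑ i, ∑ j, A i j * (u j * (v j - v i)) := by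
    rw [h1, Finset.sum_comm]
    refine Finset.sum_congr rfl fun i _ => Finset.sum_congr rfl fun j _ => ?_
    rw [hAsymm.apply]
  have h3 : ∑ i, ∑ j, A i j * ((u i - u j) * (v i - v j)) =
      u ⬝ᵥ (L *ᵥ v) + u ⬝ᵥ (L *ᵥ v) := by
    nth_rewrite 1 [h1]
    rw [h2]
    simp only [← Finset.sum_add_distrib]
    refine Finset.sum_congr rfl fun i _ => Finset.sum_congr rfl fun j _ => by ring
  rw [h3]; ring

lemma aux_symm {n : ℕ} (A L : Matrix (Fin n) (Fin n) ℝ) (hAsymm : A.IsSymm)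
    (hL : L = Matrix.diagonal (fun i => ∑ j, A i j) - A) (u v : Fin n → ℝ) :
    u ⬝ᵥ (L *ᵥ v) = v ⬝ᵥ (L *ᵥ u) := by
  rw [aux_quad A L hAsymm hL, aux_quad A L hAsymm hL]
  simp only [mul_comm]

lemma aux_psd {n : ℕ} (A L : Matrix (Fin n) (Fin n) ℝ) (hAsymm : A.IsSymm)
    (hAnonneg : ∀ i j, 0 ≤ A i j)
    (hL : L = Matrix.diagonal (fun i => ∑ j, A i j) - A) (v : Fin n → ℝ) :
    0 ≤ v ⬝ᵥ (L *ᵥ v) := by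
  rw [aux_quad A L hAsymm hL]
  exact mul_nonneg (by norm_num) (Finset.sum_nonneg fun i _ => Finset.sum_nonneg fun j _ =>
    mul_nonneg (hAnonneg i j) (mul_self_nonneg _))

lemma aux_ker {n : ℕ} (A L : Matrix (Fin n) (Fin n) ℝ) (hAsymm : A.IsSymm)
    (hAnonneg : ∀ i j, 0 ≤ A i j)
    (hconn : (SimpleGraph.fromRel (fun i j => 0 < A i j)).Connected)
    (hL : L = Matrix.diagonal (fun i => ∑ j, A i j) - A) (v : Fin n → ℝ)
    (h0 : v ⬝ᵥ (L *ᵥ v) = 0) (i j : Fin n) : v i = v j := by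
  refine aux_const hconn v (fun a b hab => ?_) i j
  rw [aux_quad A L hAsymm hL] at h0
  have hn : ∀ i j, 0 ≤ A i j * ((v i - v j) * (v i - v j)) := fun i j =>
    mul_nonneg (hAnonneg i j) (mul_self_nonneg _)
  have h1 : ∑ i, ∑ j, A i j * ((v i - v j) * (v i - v j)) = 0 := by linarith
  have h2 := (Finset.sum_eq_zero_iff_of_nonneg
    (fun i _ => Finset.sum_nonneg fun j _ => hn i j)).1 h1 a (Finset.mem_univ _)
  have h3 := (Finset.sum_eq_zero_iff_of_nonneg (fun j _ => hn a j)).1 h2 b (Finset.mem_univ _)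
  rcases mul_eq_zero.1 h3 with h | h
  · linarith
  · have := mul_self_eq_zero.1 h
    linarith

lemma aux_poincare {n : ℕ} (A L : Matrix (Fin n) (Fin n) ℝ) (hAsymm : A.IsSymm)
    (hAnonneg : ∀ i j, 0 ≤ A i j)
    (hconn : (SimpleGraph.fromRel (fun i j => 0 < A i j)).Connected)
    (hL : L = Matrix.diagonal (fun i => ∑ j, A i j) - A) (ρ₂ : ℝ)
    (hρ₂ : IsLeast {μ : ℝ | 0 < μ ∧ ∃ v : Fin n → ℝ, v ≠ 0 ∧ L.mulVec v = μ • v} ρ₂)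
    (y : Fin n → ℝ) (hy : ∑ i, y i = 0) :
    ρ₂ * ∑ i, y i ^ 2 ≤ y ⬝ᵥ (L *ᵥ y) := by
  have hH : L.IsHermitian := by
    have hA : A.IsHermitian := by
      rw [Matrix.IsHermitian, Matrix.conjTranspose_eq_transpose_of_trivial]; exact hAsymm
    rw [hL]
    exact (Matrix.isHermitian_diagonal _).sub hA
  let b := hH.eigenvectorBasis
  have hb : ∀ i, L *ᵥ (b i).ofLp = hH.eigenvalues i • (b i).ofLp := fun i =>
    hH.mulVec_eigenvectorBasis i
  have hin : ∀ u v : EuclideanSpace ℝ (Fin n), inner ℝ u v = u.ofLp ⬝ᵥ v.ofLp := fun u v => by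
    rw [EuclideanSpace.inner_eq_star_dotProduct, dotProduct_comm]; simp
  let Y : EuclideanSpace ℝ (Fin n) := WithLp.toLp 2 y
  let LY : EuclideanSpace ℝ (Fin n) := WithLp.toLp 2 (L *ᵥ y)
  have e1 : y ⬝ᵥ (L *ᵥ y) = ∑ i, inner ℝ Y (b i) * inner ℝ (b i) LY := by
    rw [b.sum_inner_mul_inner, hin]
  have e2 : ∑ i, y i ^ 2 = ∑ i, inner ℝ Y (b i) * inner ℝ (b i) Y := by
    rw [b.sum_inner_mul_inner, hin]
    simp [Y, dotProduct, sq]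
  rw [e1, e2, Finset.mul_sum]
  refine Finset.sum_le_sum fun i _ => ?_
  have e3 : inner ℝ (b i) LY = hH.eigenvalues i * inner ℝ (b i) Y := by
    rw [hin, hin]
    change (b i).ofLp ⬝ᵥ (L *ᵥ y) = _ * ((b i).ofLp ⬝ᵥ y)
    rw [aux_symm A L hAsymm hL, hb, dotProduct_smul, smul_eq_mul, dotProduct_comm]
  have hone : (b i).ofLp ⬝ᵥ (b i).ofLp = 1 := by
    rw [← hin, real_inner_self_eq_norm_sq, b.norm_eq_one]; norm_num
  have e4 : (b i).ofLp ⬝ᵥ (L *ᵥ (b i).ofLp) = hH.eigenvalues i := by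
    rw [hb, dotProduct_smul, hone, smul_eq_mul, mul_one]
  have h0 : 0 ≤ hH.eigenvalues i := by
    rw [← e4]; exact aux_psd A L hAsymm hAnonneg hL _
  rw [e3, real_inner_comm (b i) Y]
  rcases h0.eq_or_lt with h | h
  · have hc := aux_ker A L hAsymm hAnonneg hconn hL (b i).ofLp (by rw [e4, ← h])
    have : inner ℝ (b i) Y = 0 := by
      rw [hin]
      change ∑ j, (b i).ofLp j * y j = 0
      have : ∀ j, (b i).ofLp j * y j = (b i).ofLp i * y j := fun j => by rw [hc j i]
      simp only [this]
      rw [← Finset.mul_sum, hy, mul_zero]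
    simp [this]
  · have hle : ρ₂ ≤ hH.eigenvalues i := hρ₂.2 ⟨h, (b i).ofLp, by
      intro h0
      rw [h0] at hone
      simp at hone, hb i⟩
    have := mul_self_nonneg (inner ℝ (b i) Y)
    nlinarith [mul_le_mul_of_nonneg_right hle this]

lemma aux_norm {n : ℕ} (L : Matrix (Fin n) (Fin n) ℝ) (e : Fin n → ℝ) :
    e ⬝ᵥ (L *ᵥ e) ≤ ‖(Matrix.toEuclideanCLM (𝕜 := ℝ) L :
      EuclideanSpace ℝ (Fin n) →L[ℝ] EuclideanSpace ℝ (Fin n))‖ * ∑ i, e i ^ 2 := by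
  let E : EuclideanSpace ℝ (Fin n) := WithLp.toLp 2 e
  have h1 : e ⬝ᵥ (L *ᵥ e) = inner ℝ E (Matrix.toEuclideanCLM (𝕜 := ℝ) L E) := by
    rw [EuclideanSpace.inner_eq_star_dotProduct, dotProduct_comm]; simp [E]
  have h2 : ∑ i, e i ^ 2 = ‖E‖ ^ 2 := by
    rw [EuclideanSpace.real_norm_sq_eq]
  rw [h1, h2]
  calc _ ≤ ‖E‖ * ‖Matrix.toEuclideanCLM (𝕜 := ℝ) L E‖ := real_inner_le_norm _ _
    _ ≤ ‖E‖ * (‖Matrix.toEuclideanCLM (𝕜 := ℝ) L‖ * ‖E‖) := by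
      gcongr; exact ContinuousLinearMap.le_opNorm _ _
    _ = _ := by ring


/-- Under the static triggering law (24) of the discontinuous
approach, `V(t) ≤ V(0) exp(−((1 − σ_max) minᵢ Lᵢᵢ / (2 minᵢ Lᵢᵢ + ‖L‖σ_max)) ρ₂(L) t)`,
i.e. consensus is reached exponentially. -/
theorem static_trigger_discontinuous_exponential_consensus
    (n : ℕ) (hn : 2 ≤ n)
    (A : Matrix (Fin n) (Fin n) ℝ)
    (hAsymm : A.IsSymm)
    (hAnonneg : ∀ i j, 0 ≤ A i j)
    (hAdiag : ∀ i, A i i = 0)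
    (hconn : (SimpleGraph.fromRel (fun i j => 0 < A i j)).Connected)
    (L : Matrix (Fin n) (Fin n) ℝ)
    (hL : L = Matrix.diagonal (fun i => ∑ j, A i j) - A)
    (ρ₂ : ℝ)
    (hρ₂ : IsLeast {μ : ℝ | 0 < μ ∧ ∃ v : Fin n → ℝ, v ≠ 0 ∧ L.mulVec v = μ • v} ρ₂)
    (σ : Fin n → ℝ) (hσ : ∀ i, σ i ∈ Set.Ioo (0 : ℝ) 1)
    (σmax : ℝ) (hσmax : IsGreatest (Set.range σ) σmax)
    (normL : ℝ)
    (hnormL : normL = ‖(Matrix.toEuclideanCLM (𝕜 := ℝ) L :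
      EuclideanSpace ℝ (Fin n) →L[ℝ] EuclideanSpace ℝ (Fin n))‖)
    (m : ℝ) (hm : IsLeast (Set.range fun i => L i i) m)
    (x xhat : ℝ → Fin n → ℝ)
    (hx : ∀ t : ℝ, 0 ≤ t → HasDerivAt x (-(L.mulVec (xhat t))) t)
    (qhat : ℝ → Fin n → ℝ)
    (hqhat : ∀ t i, qhat t i = -(1/2) * ∑ j, L i j * (xhat t j - xhat t i)^2)
    (htrig : ∀ t : ℝ, 0 ≤ t → ∀ i,
      (xhat t i - x t i)^2 ≤ σ i / (2 * L i i) * qhat t i)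
    (xbar : ℝ) (hxbar : xbar = (1 / (n : ℝ)) * ∑ i, x 0 i)
    (V : ℝ → ℝ)
    (hV : ∀ t, V t = (1/2) * ∑ i, (x t i - xbar)^2) :
    ∀ t : ℝ, 0 ≤ t →
      V t ≤ V 0 * Real.exp (-((1 - σmax) * m / (2 * m + normL * σmax)) * ρ₂ * t) := by
  have hLii : ∀ i, L i i = ∑ j, A i j := fun i => by simp [hL, hAdiag]
  have hLij : ∀ i j, i ≠ j → L i j = -A i j := fun i j h => by simp [hL, h]
  have hpos : ∀ i, 0 < L i i := by
    intro i
    rw [hLii]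
    refine lt_of_le_of_ne (Finset.sum_nonneg fun j _ => hAnonneg i j) fun h => ?_
    have hz := (Finset.sum_eq_zero_iff_of_nonneg (fun j _ => hAnonneg i j)).1 h.symm
    have : Nontrivial (Fin n) := Fin.nontrivial_iff_two_le.2 hn
    obtain ⟨k, hk⟩ := exists_ne i
    have := aux_const hconn (Pi.single i (1:ℝ)) (fun a b hab => by
      have ha : a ≠ i := by
        rintro rfl
        exact hab.ne' (hz b (Finset.mem_univ _))
      have hb : b ≠ i := by
        rintro rfl
        rw [← hAsymm.apply] at hab
        exact hab.ne' (hz a (Finset.mem_univ _))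
      simp [ha, hb]) i k
    simp [hk] at this
  have hm0 : 0 < m := by
    obtain ⟨i, hi⟩ := hm.1
    rw [← hi]; exact hpos i
  have hmle : ∀ i, m ≤ L i i := fun i => hm.2 ⟨i, rfl⟩
  have hσle : ∀ i, σ i ≤ σmax := fun i => hσmax.2 ⟨i, rfl⟩
  have hσ01 : 0 < σmax ∧ σmax < 1 := by
    obtain ⟨i, hi⟩ := hσmax.1
    rw [← hi]; exact hσ i
  have hN0 : 0 ≤ normL := by rw [hnormL]; exact norm_nonneg _
  have hq : ∀ t i, qhat t i = (1/2) * ∑ j, A i j * (xhat t j - xhat t i)^2 := by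
    intro t i
    rw [hqhat, neg_mul, ← mul_neg, ← Finset.sum_neg_distrib]
    congr 1
    refine Finset.sum_congr rfl fun j _ => ?_
    by_cases h : i = j
    · subst h; simp
    · rw [hLij i j h]; ring
  have hq0 : ∀ t i, 0 ≤ qhat t i := fun t i => by
    rw [hq]
    exact mul_nonneg (by norm_num) (Finset.sum_nonneg fun j _ =>
      mul_nonneg (hAnonneg i j) (sq_nonneg _))
  have hQ : ∀ t, xhat t ⬝ᵥ (L *ᵥ xhat t) = ∑ i, qhat t i := by
    intro t
    rw [aux_quad A L hAsymm hL, Finset.mul_sum]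
    refine Finset.sum_congr rfl fun i _ => ?_
    rw [hq]
    congr 1
    refine Finset.sum_congr rfl fun j _ => by ring
  -- conservation
  have hone : ∀ (c : ℝ) v, (fun _ => c) ⬝ᵥ (L *ᵥ v) = 0 := fun c v => by
    rw [aux_quad A L hAsymm hL]; simp
  have hxi : ∀ t, 0 ≤ t → ∀ i, HasDerivAt (fun s => x s i) (-(L *ᵥ xhat t) i) t :=
    fun t ht i => (hasDerivAt_pi.1 (hx t ht)) i
  have hsum : ∀ t, 0 ≤ t → ∑ i, (x t i - xbar) = 0 := by
    intro t ht
    have hd : ∀ s, 0 ≤ s → HasDerivAt (fun s => ∑ i, x s i) 0 s := by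
      intro s hs
      have := HasDerivAt.fun_sum (u := Finset.univ) (fun i _ => hxi s hs i)
      refine this.congr_deriv (Eq.symm ?_)
      symm
      have h1 := hone 1 (xhat s)
      simp only [dotProduct, one_mul] at h1
      rw [Finset.sum_neg_distrib, h1, neg_zero]
    have hc := constant_of_has_deriv_right_zero (a := 0) (b := t)
      (fun s hs => (hd s hs.1).continuousAt.continuousWithinAt)
      (fun s hs => (hd s hs.1).hasDerivWithinAt) t ⟨ht, le_rfl⟩
    have hc' : ∑ i, x t i = ∑ i, x 0 i := hc
    have hn0 : (n : ℝ) ≠ 0 := by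
      have : n ≠ 0 := by omega
      exact_mod_cast this
    rw [Finset.sum_sub_distrib, hc', hxbar]
    simp
    field_simp
    simp
  -- derivative of V
  have hVd : ∀ t, 0 ≤ t → HasDerivAt V (-(x t ⬝ᵥ (L *ᵥ xhat t))) t := by
    intro t ht
    have h1 := (HasDerivAt.fun_sum (u := Finset.univ)
      (fun i _ => ((hxi t ht i).sub_const xbar).fun_pow 2)).const_mul (1/2 : ℝ)
    have h2 : V = fun s => (1/2) * ∑ i, (x s i - xbar)^2 := funext hV
    rw [h2]
    refine h1.congr_deriv (Eq.symm ?_)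
    have h3 := hone xbar (xhat t)
    have h4 : x t ⬝ᵥ (L *ᵥ xhat t) =
        x t ⬝ᵥ (L *ᵥ xhat t) - (fun _ => xbar) ⬝ᵥ (L *ᵥ xhat t) := by rw [h3, sub_zero]
    rw [h4]
    simp only [dotProduct, Finset.mul_sum]
    rw [← Finset.sum_sub_distrib, ← Finset.sum_neg_distrib]
    refine Finset.sum_congr rfl fun i _ => ?_
    push_cast
    ring
  set c := (1 - σmax) * m / (2 * m + normL * σmax) * ρ₂ with hc
  have hden : 0 < 2 * m + normL * σmax := by nlinarith [mul_nonneg hN0 hσ01.1.le]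
  have hkey : ∀ t, 0 ≤ t → -(x t ⬝ᵥ (L *ᵥ xhat t)) ≤ -c * V t := by
    intro t ht
    set e : Fin n → ℝ := xhat t - x t with he
    set Q := ∑ i, qhat t i with hQdef
    have hQ0 : 0 ≤ Q := Finset.sum_nonneg fun i _ => hq0 t i
    have hte : ∀ i, e i ^ 2 ≤ σ i / (2 * L i i) * qhat t i := fun i => htrig t ht i
    have hxe : x t = xhat t - e := by rw [he]; abel
    have s1 : x t ⬝ᵥ (L *ᵥ xhat t) = Q - e ⬝ᵥ (L *ᵥ xhat t) := by
      rw [hxe, sub_dotProduct, hQ]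
    have s2 : e ⬝ᵥ (L *ᵥ xhat t) ≤ ∑ i, (1 + σmax) / 2 * qhat t i := by
      simp only [dotProduct, aux_mulVec A L hL]
      refine Finset.sum_le_sum fun i _ => ?_
      have a1 : e i * ∑ j, A i j * (xhat t i - xhat t j) ≤
          L i i * e i ^ 2 + 1 / 2 * qhat t i := by
        rw [hq, hLii, Finset.mul_sum, Finset.sum_mul, Finset.mul_sum, Finset.mul_sum,
          ← Finset.sum_add_distrib]
        refine Finset.sum_le_sum fun j _ => ?_
        nlinarith [mul_nonneg (hAnonneg i j) (sq_nonneg (e i - (xhat t i - xhat t j) / 2))]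
      have a2 : L i i * e i ^ 2 ≤ σ i / 2 * qhat t i := by
        have := mul_le_mul_of_nonneg_left (hte i) (hpos i).le
        have h5 := (hpos i).ne'
        calc _ ≤ _ := this
          _ = _ := by field_simp
      have a3 := mul_le_mul_of_nonneg_right (hσle i) (hq0 t i)
      linarith
    rw [← Finset.mul_sum, ← hQdef] at s2
    have s3 : ∑ i, e i ^ 2 ≤ σmax / (2 * m) * Q := by
      rw [hQdef, Finset.mul_sum]
      refine Finset.sum_le_sum fun i _ => (hte i).trans ?_
      refine mul_le_mul_of_nonneg_right ?_ (hq0 t i)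
      have := hmle i
      have := hσle i
      have := hσ01.1.le
      gcongr
    have s4 : x t ⬝ᵥ (L *ᵥ x t) ≤ 2 * Q + 2 * (e ⬝ᵥ (L *ᵥ e)) := by
      have h1 := aux_psd A L hAsymm hAnonneg hL (xhat t + e)
      have h2 := aux_symm A L hAsymm hL e (xhat t)
      rw [hxe]
      rw [hQdef, ← hQ]
      simp only [Matrix.mulVec_add, Matrix.mulVec_sub, dotProduct_add, dotProduct_sub,
        add_dotProduct, sub_dotProduct] at h1 ⊢
      linarith
    have s5 : e ⬝ᵥ (L *ᵥ e) ≤ normL * (σmax / (2 * m) * Q) := by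
      have := aux_norm L e
      rw [← hnormL] at this
      exact this.trans (mul_le_mul_of_nonneg_left s3 hN0)
    have s6 : ρ₂ * (2 * V t) ≤ x t ⬝ᵥ (L *ᵥ x t) := by
      have h1 := aux_poincare A L hAsymm hAnonneg hconn hL ρ₂ hρ₂ (fun i => x t i - xbar)
        (hsum t ht)
      have h2 : (fun i => x t i - xbar) ⬝ᵥ (L *ᵥ (fun i => x t i - xbar)) =
          x t ⬝ᵥ (L *ᵥ x t) := by
        rw [aux_quad A L hAsymm hL, aux_quad A L hAsymm hL]
        simp
      rw [h2] at h1
      rw [hV]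
      linarith
    have s7 : m * (ρ₂ * (2 * V t)) ≤ (2 * m + normL * σmax) * Q := by
      have h1 := mul_le_mul_of_nonneg_left (s6.trans (s4.trans
        (add_le_add_right (mul_le_mul_of_nonneg_left s5 (by norm_num : (0:ℝ) ≤ 2)) _))) hm0.le
      refine h1.trans (le_of_eq ?_)
      field_simp
    have s8 : c * V t ≤ (1 - σmax) / 2 * Q := by
      have h1 : c * V t = (1 - σmax) / 2 * (m * (ρ₂ * (2 * V t)) / (2 * m + normL * σmax)) := by
        rw [hc]; field_simp
      rw [h1]
      refine mul_le_mul_of_nonneg_left ?_ (by linarith [hσ01.2])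
      rw [div_le_iff₀ hden]; linarith
    rw [s1]
    linarith
  intro t ht
  have hW : ∀ s, 0 ≤ s → HasDerivAt (fun s => V s * Real.exp (c * s))
      (-(x s ⬝ᵥ (L *ᵥ xhat s)) * Real.exp (c * s) + V s * (Real.exp (c * s) * c)) s := by
    intro s hs
    have h1 : HasDerivAt (fun s : ℝ => c * s) c s := by
      simpa using (hasDerivAt_id s).const_mul c
    exact (hVd s hs).mul h1.exp
  have hanti : AntitoneOn (fun s => V s * Real.exp (c * s)) (Set.Ici 0) := by
    refine antitoneOn_of_hasDerivWithinAt_nonpos (convex_Ici 0)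
      (fun s hs => (hW s hs).continuousAt.continuousWithinAt)
      (fun s hs => (hW s (interior_subset hs)).hasDerivWithinAt) ?_
    intro s hs
    have h1 := mul_le_mul_of_nonneg_right (hkey s (interior_subset hs)) (Real.exp_pos (c * s)).le
    linarith
  have h1 := hanti (Set.mem_Ici.2 le_rfl) (Set.mem_Ici.2 ht) ht
  simp only [mul_zero, Real.exp_zero, mul_one] at h1
  have h2 : -((1 - σmax) * m / (2 * m + normL * σmax)) * ρ₂ * t = -(c * t) := by
    rw [hc]; ring
  rw [h2, Real.exp_neg, ← div_eq_mul_inv, le_div_iff₀ (Real.exp_pos _)]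
  exact h1
end
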